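/- (Lemma 1.7.1(ii).) Let U₁ be a compact subset of ℚ_p. Then there exists κ₀ such that for all κ ≥ κ₀, all x ∈ U₁ and all (y10,y11,y21,y31,y32) ∈ ℚ_p⁵: u(x)·Ē(y10,y11,y21,y31,y32)·u(x)⁻¹ ∈ N̄_κ if and only if Ē(y10,y11,y21,y31,y32) ∈ N̄_κ. Equivalently, writing φ_κ for the characteristic function of N̄_κ, φ_κ(u n̄ u⁻¹) = φ_κ(n̄) for all n̄ ∈ N̄ and all u = u(x) with x ∈ U₁. -/

import Mathlib

open Matrix

/-- The general element of the split Lie algebra of type `G₂`, realized as a `7 × 7` matrix. -/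
def Xmat {k : Type*} [Field k]
    (a b x01 x10 x11 x21 x31 x32 y01 y10 y11 y21 y31 y32 : k) :
    Matrix (Fin 7) (Fin 7) k :=
  !![a, x01, x32, 0, -x21, y10, 2*x11;
     y01, b, x31, x21, 0, -y11, 2*x10;
     y32, y31, -a-b, -y10, y11, 0, 2*y21;
     0, y21, -x10, -a, -y01, -y32, 2*y11;
     -y21, 0, x11, -x01, -b, -y31, 2*y10;
     x10, -x11, 0, -x32, -x31, a+b, 2*x21;
     y11, y10, x21, x11, x10, y21, 0]

/-- The exponential of a `7 × 7` matrix as a finite sum; for a nilpotent matrix (such as any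
nilpotent element of `G₂ ⊂ gl₇`) this is the genuine exponential, since `A ^ 7 = 0`. -/
noncomputable def mexp {k : Type*} [Field k] (A : Matrix (Fin 7) (Fin 7) k) :
    Matrix (Fin 7) (Fin 7) k :=
  ∑ i ∈ Finset.range 7, (Nat.factorial i : k)⁻¹ • A ^ i

/-- `E(x10, x11, x21, x31, x32)`: the exponential of the nilpotent element of `G₂` with upper
coordinates `x10, x11, x21, x31, x32` (and `x01 = 0`). -/
noncomputable def Emat {k : Type*} [Field k] (x10 x11 x21 x31 x32 : k) :
    Matrix (Fin 7) (Fin 7) k :=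
  mexp (Xmat 0 0 0 x10 x11 x21 x31 x32 0 0 0 0 0 0)

/-- `Ē(y10, y11, y21, y31, y32)`: the exponential of the nilpotent element of `G₂` with lower
coordinates `y10, y11, y21, y31, y32` (and `y01 = 0`). -/
noncomputable def Ebar {k : Type*} [Field k] (y10 y11 y21 y31 y32 : k) :
    Matrix (Fin 7) (Fin 7) k :=
  mexp (Xmat 0 0 0 0 0 0 0 0 0 y10 y11 y21 y31 y32)

/-- `u(x)`: the exponential of the nilpotent element of `G₂` with `x01 = x`, i.e. the simple
root vector in the Levi subgroup `GL₂ = M ⊂ G₂`. -/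
noncomputable def umat {k : Type*} [Field k] (x : k) : Matrix (Fin 7) (Fin 7) k :=
  mexp (Xmat 0 0 x 0 0 0 0 0 0 0 0 0 0 0)

/-- `z(t) = diag(t, t, t⁻², t⁻¹, t⁻¹, t², 1)`: the image of the central element `t·I₂` of the
Levi subgroup `GL₂ = M ⊂ G₂`. -/
noncomputable def zmat {k : Type*} [Field k] (t : k) : Matrix (Fin 7) (Fin 7) k :=
  Matrix.diagonal ![t, t, (t^2)⁻¹, t⁻¹, t⁻¹, t^2, 1]

/-- The compact open subset `N̄_κ ⊂ N̄`: the set of `Ē(y10,y11,y21,y31,y32)` with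
`v(y10) ≥ -κ²`, `v(y11) ≥ -κ`, `v(y21) ≥ -κ³`, `v(y31) ≥ -κ⁵`, `v(y32) ≥ -κ⁴`,
equivalently `‖y10‖ ≤ p^(κ²)`, `‖y11‖ ≤ p^κ`, `‖y21‖ ≤ p^(κ³)`, `‖y31‖ ≤ p^(κ⁵)`,
`‖y32‖ ≤ p^(κ⁴)`. -/
def NbarK (p : ℕ) [Fact p.Prime] (κ : ℕ) : Set (Matrix (Fin 7) (Fin 7) ℚ_[p]) :=
  {M | ∃ y10 y11 y21 y31 y32 : ℚ_[p],
    ‖y10‖ ≤ (p : ℝ)^(κ^2) ∧ ‖y11‖ ≤ (p : ℝ)^κ ∧ ‖y21‖ ≤ (p : ℝ)^(κ^3) ∧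
    ‖y31‖ ≤ (p : ℝ)^(κ^5) ∧ ‖y32‖ ≤ (p : ℝ)^(κ^4) ∧
    M = Ebar y10 y11 y21 y31 y32}

lemma mexp_conj {k : Type*} [Field k] {U V : Matrix (Fin 7) (Fin 7) k} (h : V * U = 1)
    (A : Matrix (Fin 7) (Fin 7) k) : U * mexp A * V = mexp (U * A * V) := by
  have h' : U * V = 1 := mul_eq_one_comm.mp h
  have hpow : ∀ i : ℕ, (U * A * V) ^ i = U * A ^ i * V := by
    intro i
    induction i with
    | zero => simp [h']
    | succ n ih =>
      rw [pow_succ, ih, pow_succ]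
      calc U * A ^ n * V * (U * A * V) = U * A ^ n * (V * U) * A * V := by noncomm_ring
        _ = U * (A ^ n * A) * V := by rw [h]; noncomm_ring
  simp only [mexp, hpow, Finset.mul_sum, Finset.sum_mul, Matrix.mul_smul, Matrix.smul_mul]

lemma umat_eq {k : Type*} [Field k] (x : k) :
    umat x = 1 + Xmat 0 0 x 0 0 0 0 0 0 0 0 0 0 0 := by
  have h : (Xmat 0 0 x 0 0 0 0 0 0 0 0 0 0 0) ^ 2 = 0 := by
    rw [pow_two]
    ext i j
    fin_cases i <;> fin_cases j <;> simp [Xmat, Matrix.mul_apply, Fin.sum_univ_succ]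
  have hn : ∀ n, (Xmat 0 0 x 0 0 0 0 0 0 0 0 0 0 0) ^ (n + 2) = 0 := fun n => by
    rw [pow_add, h, mul_zero]
  simp [umat, mexp, Finset.sum_range_succ, h, hn 1, hn 2, hn 3, hn 4]

lemma umat_neg_mul_umat {k : Type*} [Field k] (x : k) : umat (-x) * umat x = 1 := by
  rw [umat_eq, umat_eq]
  ext i j
  fin_cases i <;> fin_cases j <;>
    simp [Xmat, Matrix.mul_apply, Fin.sum_univ_succ, Matrix.one_apply]

lemma umat_inv {k : Type*} [Field k] (x : k) : (umat x)⁻¹ = umat (-x) :=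
  Matrix.inv_eq_left_inv (umat_neg_mul_umat x)

lemma umat_conj_Ebar {k : Type*} [Field k] (x y10 y11 y21 y31 y32 : k) :
    umat x * Ebar y10 y11 y21 y31 y32 * (umat x)⁻¹ =
      Ebar (y10 - x * y11) y11 y21 (y31 - x * y32) y32 := by
  rw [umat_inv, Ebar, mexp_conj (umat_neg_mul_umat x), Ebar]
  congr 1
  rw [umat_eq, umat_eq]
  ext i j
  fin_cases i <;> fin_cases j <;>
    simp [Xmat, Matrix.mul_apply, Fin.sum_univ_succ, Matrix.one_apply] <;> ring

lemma Ebar_col_five {k : Type*} [Field k] (y10 y11 y21 y31 y32 : k) :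
    ∃ s : k, Ebar y10 y11 y21 y31 y32 *ᵥ ![0, 0, 0, 0, 0, 1, 0] =
      ![y10, -y11, s, -y32 + y11 * y21 / 2, -y31 + y10 * y21 / 2, 1, y21] := by
  set A := Xmat 0 0 0 0 0 0 0 0 0 y10 y11 y21 y31 y32 with hA
  have h1 : A *ᵥ ![0, 0, 0, 0, 0, 1, 0] = ![y10, -y11, 0, -y32, -y31, 0, y21] := by
    ext i
    fin_cases i <;> simp [hA, Xmat, Matrix.mulVec, dotProduct, Fin.sum_univ_succ]
  obtain ⟨s, h2⟩ : ∃ s, A *ᵥ ![y10, -y11, 0, -y32, -y31, 0, y21] =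
      ![0, 0, s, y11 * y21, y10 * y21, 0, 0] := by
    refine ⟨(A *ᵥ ![y10, -y11, 0, -y32, -y31, 0, y21]) 2, ?_⟩
    ext i
    fin_cases i <;> simp [hA, Xmat, Matrix.mulVec, dotProduct, Fin.sum_univ_succ] <;> ring
  obtain ⟨t, h3⟩ : ∃ t, A *ᵥ ![0, 0, s, y11 * y21, y10 * y21, 0, 0] =
      ![0, 0, t, 0, 0, 0, 0] := by
    refine ⟨(A *ᵥ ![0, 0, s, y11 * y21, y10 * y21, 0, 0]) 2, ?_⟩
    ext i
    fin_cases i <;> simp [hA, Xmat, Matrix.mulVec, dotProduct, Fin.sum_univ_succ]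
  have h4 : A *ᵥ ![0, 0, t, 0, 0, 0, 0] = 0 := by
    ext i
    fin_cases i <;> simp [hA, Xmat, Matrix.mulVec, dotProduct, Fin.sum_univ_succ]
  refine ⟨s / 2 + t / 6, ?_⟩
  rw [Ebar, ← hA, mexp]
  simp only [Finset.sum_range_succ, Finset.sum_range_zero, pow_succ', pow_zero, mul_one,
    Matrix.add_mulVec, Matrix.smul_mulVec, ← Matrix.mulVec_mulVec, h1, h2, h3, h4,
    Matrix.mulVec_zero, Matrix.one_mulVec, zero_add, smul_zero, add_zero]
  ext i
  fin_cases i <;> simp [Nat.factorial] <;> ring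

lemma Ebar_injective {k : Type*} [Field k]
    {y10 y11 y21 y31 y32 z10 z11 z21 z31 z32 : k}
    (h : Ebar y10 y11 y21 y31 y32 = Ebar z10 z11 z21 z31 z32) :
    y10 = z10 ∧ y11 = z11 ∧ y21 = z21 ∧ y31 = z31 ∧ y32 = z32 := by
  obtain ⟨s, hs⟩ := Ebar_col_five y10 y11 y21 y31 y32
  obtain ⟨t, ht⟩ := Ebar_col_five z10 z11 z21 z31 z32
  rw [h, ht] at hs
  have h0 : z10 = y10 := congrFun hs 0
  have h1 : -z11 = -y11 := congrFun hs 1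
  have h3 : -z32 + z11 * z21 / 2 = -y32 + y11 * y21 / 2 := congrFun hs 3
  have h4 : -z31 + z10 * z21 / 2 = -y31 + y10 * y21 / 2 := congrFun hs 4
  have h6 : z21 = y21 := congrFun hs 6
  obtain rfl := neg_injective h1
  subst h0 h6
  exact ⟨rfl, rfl, rfl, (neg_injective (add_right_cancel h4)).symm,
    (neg_injective (add_right_cancel h3)).symm⟩

lemma Ebar_mem_NbarK_iff {p : ℕ} [Fact p.Prime] {κ : ℕ} {y10 y11 y21 y31 y32 : ℚ_[p]} :
    Ebar y10 y11 y21 y31 y32 ∈ NbarK p κ ↔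
      ‖y10‖ ≤ (p : ℝ) ^ (κ ^ 2) ∧ ‖y11‖ ≤ (p : ℝ) ^ κ ∧ ‖y21‖ ≤ (p : ℝ) ^ (κ ^ 3) ∧
      ‖y31‖ ≤ (p : ℝ) ^ (κ ^ 5) ∧ ‖y32‖ ≤ (p : ℝ) ^ (κ ^ 4) := by
  constructor
  · rintro ⟨z10, z11, z21, z31, z32, h10, h11, h21, h31, h32, h⟩
    obtain ⟨rfl, rfl, rfl, rfl, rfl⟩ := Ebar_injective h
    exact ⟨h10, h11, h21, h31, h32⟩
  · rintro ⟨h10, h11, h21, h31, h32⟩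
    exact ⟨_, _, _, _, _, h10, h11, h21, h31, h32, rfl⟩

lemma norm_sub_le_iff_of_ultrametric {E : Type*} [SeminormedAddCommGroup E]
    [IsUltrametricDist E] {a b : E} {r : ℝ} (hb : ‖b‖ ≤ r) : ‖a - b‖ ≤ r ↔ ‖a‖ ≤ r := by
  constructor
  · intro h
    simpa using (IsUltrametricDist.norm_add_le_max (a - b) b).trans (max_le h hb)
  · intro h
    simpa [sub_eq_add_neg] using
      (IsUltrametricDist.norm_add_le_max a (-b)).trans (max_le h (by rwa [norm_neg]))

/-- Lemma 1.7.1(ii): if `U₁` is a compact subset of `ℚ_p`, then for all sufficiently large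
`κ`, conjugation by `u(x)` with `x ∈ U₁` preserves membership in `N̄_κ`: writing `φ_κ` for
the characteristic function of `N̄_κ`, `φ_κ(u n̄ u⁻¹) = φ_κ(n̄)` for all `n̄ ∈ N̄` and all
`u = u(x)`, `x ∈ U₁`. -/
theorem nbar_kappa_stable_under_UM (p : ℕ) [Fact p.Prime]
    (U₁ : Set ℚ_[p]) (hU₁ : IsCompact U₁) :
    ∃ κ₀ : ℕ, ∀ κ : ℕ, κ₀ ≤ κ → ∀ x ∈ U₁, ∀ y10 y11 y21 y31 y32 : ℚ_[p],
      (umat x * Ebar y10 y11 y21 y31 y32 * (umat x)⁻¹ ∈ NbarK p κ ↔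
        Ebar y10 y11 y21 y31 y32 ∈ NbarK p κ) := by
  obtain ⟨C, hC⟩ := hU₁.isBounded.exists_norm_le
  have hp : (1 : ℝ) < p := by exact_mod_cast (Fact.out : p.Prime).one_lt
  obtain ⟨m, hm⟩ := pow_unbounded_of_one_lt C hp
  refine ⟨max 2 m, fun κ hκ x hx y10 y11 y21 y31 y32 => ?_⟩
  have h2 : 2 ≤ κ := (le_max_left _ _).trans hκ
  have hmκ : m ≤ κ := (le_max_right _ _).trans hκ
  have hmul : ∀ (n : ℕ) (y : ℚ_[p]), 1 ≤ n → ‖y‖ ≤ (p : ℝ) ^ κ ^ n →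
      ‖x * y‖ ≤ (p : ℝ) ^ κ ^ (n + 1) := by
    intro n y hn hy
    have hle : m + κ ^ n ≤ κ ^ (n + 1) := by
      have : κ ≤ κ ^ n := Nat.le_self_pow (by lia) κ
      calc m + κ ^ n ≤ κ ^ n * 2 := by lia
        _ ≤ κ ^ (n + 1) := Nat.mul_le_mul_left _ h2
    calc ‖x * y‖ = ‖x‖ * ‖y‖ := norm_mul x y
      _ ≤ (p : ℝ) ^ m * (p : ℝ) ^ κ ^ n := by
        gcongr
        exact (hC x hx).trans hm.le
      _ = (p : ℝ) ^ (m + κ ^ n) := (pow_add _ _ _).symm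
      _ ≤ (p : ℝ) ^ κ ^ (n + 1) := pow_le_pow_right₀ hp.le hle
  rw [umat_conj_Ebar, Ebar_mem_NbarK_iff, Ebar_mem_NbarK_iff]
  by_cases h11 : ‖y11‖ ≤ (p : ℝ) ^ κ
  · by_cases h32 : ‖y32‖ ≤ (p : ℝ) ^ κ ^ 4
    · rw [norm_sub_le_iff_of_ultrametric (hmul 1 y11 le_rfl (by simpa using h11)),
        norm_sub_le_iff_of_ultrametric (hmul 4 y32 (by simp) h32)]
    · simp [h32]
  · simp [h11]
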